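/- arXiv:2010.13362 — 6 statements merged into one kernel-verified Lean document; each statement's English description precedes it below -/
import Mathlib

section
/- For every integer d ≥ 1 there exists a natural number D_max, depending only on d, with the following property: for every finite set U of points in Euclidean space ℝ^d and every minimal spanning tree T of U, every vertex of T has degree at most D_max. (Lemma 3.2 of the paper: the vertex degrees of an arbitrary Euclidean minimal spanning tree are uniformly bounded by a constant depending only on the dimension.) -/
noncomputable section

/-- Points of Euclidean space `ℝ^d`. -/
abbrev Pt (d : ℕ) : Type := EuclideanSpace ℝ (Fin d)

/-- A spanning tree of a finite point set `U ⊆ ℝ^d` is a connected acyclic simple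
graph on the vertex set `U`. -/
def IsSpanningTree {d : ℕ} (U : Finset (Pt d)) (T : SimpleGraph ↥U) : Prop :=
  T.Connected ∧ T.IsAcyclic

/-- The total (Euclidean) edge length of a graph on a finite point set. -/
noncomputable def treeLength {d : ℕ} (U : Finset (Pt d)) (T : SimpleGraph ↥U) : ℝ :=
  ∑ᶠ e ∈ T.edgeSet,
    (Sym2.lift ⟨fun a b => dist (a : Pt d) (b : Pt d), fun _ _ => dist_comm _ _⟩ :
      Sym2 ↥U → ℝ) e

/-- A minimal spanning tree of `U`: a spanning tree minimizing the total edge length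
among all spanning trees of `U`. -/
def IsMST {d : ℕ} (U : Finset (Pt d)) (T : SimpleGraph ↥U) : Prop :=
  IsSpanningTree U T ∧
    ∀ T' : SimpleGraph ↥U, IsSpanningTree U T' → treeLength U T ≤ treeLength U T'

/-- Two nonzero vectors at distance at least both of their norms form an angle of at least `π / 3`,
so the corresponding unit vectors are at distance at least `1`. -/
theorem one_le_norm_normalize_sub_normalize {E : Type*} [NormedAddCommGroup E]
    [InnerProductSpace ℝ E] {a b : E} (ha : a ≠ 0) (hb : b ≠ 0)
    (hab : ‖a‖ ≤ ‖a - b‖) (hba : ‖b‖ ≤ ‖a - b‖) :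
    1 ≤ ‖NormedSpace.normalize a - NormedSpace.normalize b‖ := by
  have ha' : 0 < ‖a‖ := norm_pos_iff.2 ha
  have hb' : 0 < ‖b‖ := norm_pos_iff.2 hb
  have hinner : 2 * inner ℝ a b ≤ ‖a‖ * ‖b‖ := by
    have h := norm_sub_sq_real a b
    have h1 := pow_le_pow_left₀ ha'.le hab 2
    have h2 := pow_le_pow_left₀ hb'.le hba 2
    rcases le_total ‖a‖ ‖b‖ with hle | hle <;> nlinarith
  have hnorm := norm_sub_sq_real (NormedSpace.normalize a) (NormedSpace.normalize b)
  rw [NormedSpace.norm_normalize ha, NormedSpace.norm_normalize hb, NormedSpace.normalize,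
    NormedSpace.normalize, real_inner_smul_left, real_inner_smul_right] at hnorm
  have hle : ‖a‖⁻¹ * (‖b‖⁻¹ * inner ℝ a b) ≤ 1 / 2 := by
    rw [← mul_assoc, ← mul_inv, inv_mul_le_iff₀ (by positivity)]
    linarith
  refine (one_le_sq_iff₀ (norm_nonneg _)).1 ?_
  simp only [NormedSpace.normalize] at hnorm ⊢
  linarith

/-- Replacing an edge `vp` of a tree by `pq`, where `q` is another neighbour of `v`, yields a
tree. -/
theorem SimpleGraph.IsTree.deleteEdges_sup_edge {V : Type*} {T : SimpleGraph V} (hT : T.IsTree)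
    {v p q : V} (hp : T.Adj v p) (hq : T.Adj v q) (hpq : p ≠ q) :
    (T.deleteEdges {s(v, p)} ⊔ edge p q).IsTree := by
  have hbridge : ¬ (T.deleteEdges {s(v, p)}).Reachable v p :=
    isBridge_iff.1 (isAcyclic_iff_forall_adj_isBridge.1 hT.isAcyclic hp)
  have hvq : (T.deleteEdges {s(v, p)}).Adj v q := by
    rw [deleteEdges_adj]
    refine ⟨hq, fun h => hpq ?_⟩
    exact (Sym2.congr_right.1 (Set.mem_singleton_iff.1 h)).symm
  have hvq' : (T.deleteEdges {s(v, p)} ⊔ edge p q).Adj v q := Or.inl hvq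
  have hpq' : (T.deleteEdges {s(v, p)} ⊔ edge p q).Adj p q :=
    Or.inr ((edge_adj p q p q).2 ⟨Or.inl ⟨rfl, rfl⟩, hpq⟩)
  have hvp : (T.deleteEdges {s(v, p)} ⊔ edge p q).Reachable v p :=
    hvq'.reachable.trans hpq'.reachable.symm
  have hadj : ∀ a b, T.Adj a b →
      (T.deleteEdges {s(v, p)} ⊔ edge p q).Reachable a b := by
    intro a b hab
    by_cases h : s(a, b) = s(v, p)
    · rcases Sym2.eq_iff.1 h with ⟨rfl, rfl⟩ | ⟨rfl, rfl⟩
      · exact hvp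
      · exact hvp.symm
    · exact Adj.reachable (Or.inl ((deleteEdges_adj ..).2 ⟨hab, h⟩))
  have := hT.connected.nonempty
  refine ⟨⟨fun a b => ?_⟩, ?_⟩
  · obtain ⟨w⟩ := hT.connected.preconnected a b
    induction w with
    | nil => exact Reachable.refl _
    | cons h _ ih => exact (hadj _ _ h).trans ih
  · exact (hT.isAcyclic.anti (deleteEdges_le _)).sup_edge_of_not_reachable
      fun h => hbridge (hvq.reachable.trans h.symm)

/-- Exchange property: in a minimal spanning tree, an edge at `v` is no longer than the distance
from its other end to any other neighbour of `v`. -/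
theorem IsMST.dist_le_of_adj_of_adj {d : ℕ} {U : Finset (Pt d)} {T : SimpleGraph ↥U}
    (hT : IsMST U T) {v p q : ↥U} (hp : T.Adj v p) (hq : T.Adj v q) (hpq : p ≠ q) :
    dist (v : Pt d) p ≤ dist (p : Pt d) q := by
  have htree : T.IsTree := ⟨hT.1.1, hT.1.2⟩
  have htree' := htree.deleteEdges_sup_edge hp hq hpq
  have hle := hT.2 _ ⟨htree'.connected, htree'.isAcyclic⟩
  have hnot : ¬ T.Adj p q := fun h =>
    htree.isAcyclic.cliqueFree le_rfl {v, p, q}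
      (SimpleGraph.is3Clique_triple_iff.2 ⟨hp, hq, h⟩)
  have hedges : (T.deleteEdges {s(v, p)} ⊔ SimpleGraph.edge p q).edgeSet =
      insert s(p, q) (T.edgeSet \ {s(v, p)}) := by
    rw [SimpleGraph.edgeSet_sup, SimpleGraph.edgeSet_deleteEdges,
      SimpleGraph.edgeSet_edge_of_ne hpq, Set.union_singleton]
  have hsplit : T.edgeSet = insert s(v, p) (T.edgeSet \ {s(v, p)}) := by
    rw [Set.insert_sdiff_singleton, Set.insert_eq_of_mem (T.mem_edgeSet.2 hp)]
  unfold treeLength at hle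
  rw [hedges, finsum_mem_insert _ (fun h => hnot h.1) (Set.toFinite _)] at hle
  rw [hsplit, finsum_mem_insert _ (fun h => h.2 rfl) (Set.toFinite _), ← hsplit] at hle
  simpa using hle

/-- For every `d ≥ 1` there is a constant `D_max`, depending only on
`d`, bounding the degree of every vertex of every Euclidean minimal spanning tree of a
finite subset of `ℝ^d`. -/
theorem mst_degree_uniformly_bounded (d : ℕ) (hd : 1 ≤ d) :
    ∃ D : ℕ, ∀ (U : Finset (Pt d)) (T : SimpleGraph ↥U), IsMST U T →
      ∀ v : ↥U, Nat.card (T.neighborSet v) ≤ D := by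
  refine ⟨5 ^ d, fun U T hT v => ?_⟩
  classical
  have hpos : ∀ w : T.neighborSet v, ((w : ↥U) : Pt d) - v ≠ 0 := fun w h =>
    w.2.ne (Subtype.ext (sub_eq_zero.1 h).symm)
  have hdist : ∀ p q : T.neighborSet v, p ≠ q →
      ‖((p : ↥U) : Pt d) - v‖ ≤ ‖(((p : ↥U) : Pt d) - v) - (((q : ↥U) : Pt d) - v)‖ := by
    intro p q hpq
    have h := hT.dist_le_of_adj_of_adj p.2 q.2 (fun h => hpq (Subtype.ext h))
    rwa [dist_comm, dist_eq_norm, dist_eq_norm, ← sub_sub_sub_cancel_right (p : Pt d) q v] at h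
  set f : T.neighborSet v → Pt d := fun w => NormedSpace.normalize (((w : ↥U) : Pt d) - v) with hf
  have hsep : ∀ p q : T.neighborSet v, p ≠ q → 1 ≤ ‖f p - f q‖ := fun p q hpq =>
    one_le_norm_normalize_sub_normalize (hpos p) (hpos q) (hdist p q hpq)
      (by rw [norm_sub_rev (((p : ↥U) : Pt d) - v)]; exact hdist q p hpq.symm)
  have hinj : Function.Injective f := by
    intro p q h
    by_contra hpq
    have := hsep p q hpq
    rw [h, sub_self, norm_zero] at this
    linarith
  have hcard := Besicovitch.card_le_of_separated (Finset.univ.image f)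
    (by
      intro c hc
      obtain ⟨p, -, rfl⟩ := Finset.mem_image.1 hc
      rw [hf, NormedSpace.norm_normalize (hpos p)]
      norm_num)
    (by
      intro c hc e he hce
      obtain ⟨p, -, rfl⟩ := Finset.mem_image.1 hc
      obtain ⟨q, -, rfl⟩ := Finset.mem_image.1 he
      exact hsep p q fun h => hce (congrArg f h))
  rw [Finset.card_image_of_injective _ hinj, Finset.card_univ, finrank_euclideanSpace_fin] at hcard
  rwa [Nat.card_eq_fintype_card]

end
end

section
/- Let d ≥ 1 be an integer, n > 0, and let U be a finite subset of the cube Q_n(0) ⊂ ℝ^d. Let x ∈ Q_n(0) with x ∉ U, assume U ∪ {x} has distinct interpoint distances, and let 0 < u < 2n. Suppose x is surrounded by a U-wall in Q_n(0) at scale u, i.e., for every point x' ∈ Q_n(0) lying on the boundary of the cube Q_u(x) there exists z ∈ U with ‖z − x‖ ≤ (3/4)‖x' − x‖ and ‖z − x'‖ ≤ (3/4)‖x' − x‖ (Euclidean norms). Then every neighbour of x in any minimal spanning tree of U ∪ {x} lies in the cube Q_u(x); equivalently, no y ∈ U with y ∉ Q_u(x) is joined to x by an edge of the MST of U ∪ {x}.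 -/
open scoped Classical

noncomputable section

/-- `U` has distinct interpoint distances: the distance map is injective on unordered
pairs of distinct points of `U`. -/
def DistinctDistances {d : ℕ} (U : Set (Pt d)) : Prop :=
  ∀ ⦃a⦄, a ∈ U → ∀ ⦃b⦄, b ∈ U → ∀ ⦃c⦄, c ∈ U → ∀ ⦃e⦄, e ∈ U →
    a ≠ b → c ≠ e → dist a b = dist c e → (a = c ∧ b = e) ∨ (a = e ∧ b = c)

/-- `Q_a(x)`: the closed axis-parallel cube of side length `a` centered at `x`. -/
def cube {d : ℕ} (a : ℝ) (x : Pt d) : Set (Pt d) :=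
  {y | ∀ i, |y i - x i| ≤ a / 2}

/-- In a connected graph, after removing the edge `s(a, b)` every vertex is still reachable from
one of its endpoints. -/
theorem SimpleGraph.Connected.reachable_deleteEdges_or {V : Type*} {G : SimpleGraph V}
    (hG : G.Connected) (a b v : V) :
    (G.deleteEdges {s(a, b)}).Reachable v a ∨ (G.deleteEdges {s(a, b)}).Reachable v b := by
  obtain ⟨p⟩ := hG.preconnected v a
  induction p with
  | nil => exact Or.inl (SimpleGraph.Reachable.refl _)
  | @cons v w a hvw p ih =>
    by_cases he : s(v, w) = s(a, b)
    · rcases Sym2.eq_iff.1 he with ⟨rfl, -⟩ | ⟨rfl, -⟩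
      · exact Or.inl (SimpleGraph.Reachable.refl _)
      · exact Or.inr (SimpleGraph.Reachable.refl _)
    · have hr : (G.deleteEdges {s(a, b)}).Reachable v w :=
        SimpleGraph.Adj.reachable (SimpleGraph.deleteEdges_adj.2 ⟨hvw, he⟩)
      exact ih.imp hr.trans hr.trans

/-- Replacing the edge `s(a, b)` of a connected graph by `s(c, b)`, where `c` is still reachable
from `a`, keeps the graph connected. -/
theorem SimpleGraph.Connected.deleteEdges_sup_edge {V : Type*} {G : SimpleGraph V}
    (hG : G.Connected) {a b c : V} (hca : (G.deleteEdges {s(a, b)}).Reachable c a)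
    (hcb : c ≠ b) : (G.deleteEdges {s(a, b)} ⊔ SimpleGraph.edge c b).Connected := by
  have hle : G.deleteEdges {s(a, b)} ≤ G.deleteEdges {s(a, b)} ⊔ SimpleGraph.edge c b := le_sup_left
  have hab : (G.deleteEdges {s(a, b)} ⊔ SimpleGraph.edge c b).Reachable b a := by
    refine SimpleGraph.Reachable.trans (SimpleGraph.Adj.reachable (Or.inr ?_)) (hca.mono hle)
    simp [SimpleGraph.edge_adj, hcb, hcb.symm]
  have key : ∀ v, (G.deleteEdges {s(a, b)} ⊔ SimpleGraph.edge c b).Reachable v a := fun v =>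
    (hG.reachable_deleteEdges_or a b v).elim (fun h => h.mono hle) fun h => (h.mono hle).trans hab
  exact SimpleGraph.connected_iff _ |>.2 ⟨fun v w => (key v).trans (key w).symm, ⟨a⟩⟩

/-- The Euclidean length of an unordered pair of points. -/
def edgeLength {d : ℕ} (U : Finset (Pt d)) : Sym2 ↥U → ℝ :=
  Sym2.lift ⟨fun a b => dist (a : Pt d) (b : Pt d), fun _ _ => dist_comm _ _⟩

theorem edgeLength_nonneg {d : ℕ} (U : Finset (Pt d)) (e : Sym2 ↥U) : 0 ≤ edgeLength U e := by
  induction e with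
  | h a b => exact dist_nonneg (x := (a : Pt d)) (y := (b : Pt d))

theorem treeLength_eq_sum {d : ℕ} (U : Finset (Pt d)) (T : SimpleGraph ↥U)
    [Fintype T.edgeSet] : treeLength U T = ∑ e ∈ T.edgeFinset, edgeLength U e := by
  rw [← finsum_mem_coe_finset, SimpleGraph.coe_edgeFinset]
  rfl

theorem treeLength_mono {d : ℕ} (U : Finset (Pt d)) {T T' : SimpleGraph ↥U} (h : T ≤ T') :
    treeLength U T ≤ treeLength U T' := by
  rw [treeLength_eq_sum, treeLength_eq_sum]
  exact Finset.sum_le_sum_of_subset_of_nonneg (SimpleGraph.edgeFinset_mono h)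
    fun e _ _ => edgeLength_nonneg U e

/-- An edge `s(a, b)` of a minimal spanning tree is at most as long as `s(c, b)` if `c` is in the
component of `a` after removing the edge. -/
theorem IsMST.dist_le_of_reachable {d : ℕ} {U : Finset (Pt d)} {T : SimpleGraph ↥U}
    (hT : IsMST U T) {a b c : ↥U} (hab : T.Adj a b)
    (hca : (T.deleteEdges {s(a, b)}).Reachable c a) (hcb : c ≠ b) :
    dist (a : Pt d) (b : Pt d) ≤ dist (c : Pt d) (b : Pt d) := by
  obtain ⟨T', hle, hT'⟩ := (hT.1.1.deleteEdges_sup_edge hca hcb).exists_isTree_le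
  have h := (hT.2 T' ⟨hT'.1, hT'.2⟩).trans (treeLength_mono U hle)
  have hsub : (T.deleteEdges {s(a, b)} ⊔ SimpleGraph.edge c b).edgeFinset ⊆
      insert s(c, b) (T.edgeFinset.erase s(a, b)) := by
    intro e he
    rw [SimpleGraph.mem_edgeFinset, SimpleGraph.edgeSet_sup] at he
    rcases he with he | he
    · rw [SimpleGraph.edgeSet_deleteEdges] at he
      exact Finset.mem_insert_of_mem
        (Finset.mem_erase.2 ⟨he.2, SimpleGraph.mem_edgeFinset.2 he.1⟩)
    · exact Finset.mem_insert.2 (Or.inl (SimpleGraph.edgeSet_edge_subset he))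
  have h1 := Finset.sum_le_sum_of_subset_of_nonneg hsub fun e _ _ => edgeLength_nonneg U e
  have h2 : ∑ e ∈ insert s(c, b) (T.edgeFinset.erase s(a, b)), edgeLength U e ≤
      edgeLength U s(c, b) + ∑ e ∈ T.edgeFinset.erase s(a, b), edgeLength U e := by
    by_cases hmem : s(c, b) ∈ T.edgeFinset.erase s(a, b)
    · rw [Finset.insert_eq_of_mem hmem]
      exact le_add_of_nonneg_left (edgeLength_nonneg U _)
    · exact (Finset.sum_insert hmem).le
  have h3 := Finset.sum_erase_add T.edgeFinset (edgeLength U)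
    (SimpleGraph.mem_edgeFinset.2 (T.mem_edgeSet.2 hab))
  rw [treeLength_eq_sum, treeLength_eq_sum] at h
  have h4 : edgeLength U s(a, b) ≤ edgeLength U s(c, b) := by linarith
  exact h4

/-- An edge of a minimal spanning tree is not the strictly longest side of a triangle. -/
theorem IsMST.not_adj_of_dist_lt {d : ℕ} {U : Finset (Pt d)} {T : SimpleGraph ↥U}
    (hT : IsMST U T) {a b c : ↥U} (hca : dist (c : Pt d) (a : Pt d) < dist (a : Pt d) (b : Pt d))
    (hcb : dist (c : Pt d) (b : Pt d) < dist (a : Pt d) (b : Pt d)) : ¬ T.Adj a b := by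
  intro hab
  rcases hT.1.1.reachable_deleteEdges_or a b c with h | h
  · refine hcb.not_ge (hT.dist_le_of_reachable hab h ?_)
    rintro rfl
    rw [dist_comm] at hca
    exact lt_irrefl _ hca
  · rw [Sym2.eq_swap] at h
    rw [dist_comm (a : Pt d)] at hca
    refine hca.not_ge (hT.dist_le_of_reachable hab.symm h ?_)
    rintro rfl
    rw [dist_comm] at hcb
    exact lt_irrefl _ hcb

/-- A preconnected set meeting both a set and its complement meets its frontier. -/
theorem IsPreconnected.inter_frontier_nonempty {X : Type*} [TopologicalSpace X] {s t : Set X}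
    (hs : IsPreconnected s) (ht : (s ∩ t).Nonempty) (htc : (s ∩ tᶜ).Nonempty) :
    (s ∩ frontier t).Nonempty := by
  by_contra hne
  have hcover : ∀ p ∈ s, p ∈ interior t ∨ p ∈ interior tᶜ := by
    intro p hp
    by_contra! h
    rw [interior_compl, Set.mem_compl_iff, not_not] at h
    exact hne ⟨p, hp, h.2, h.1⟩
  obtain ⟨p, hps, hpt⟩ := ht
  obtain ⟨q, hqs, hqt⟩ := htc
  obtain ⟨r, -, hr, hr'⟩ := hs _ _ isOpen_interior isOpen_interior hcover
    ⟨p, hps, (hcover p hps).resolve_right fun h => interior_subset h hpt⟩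
    ⟨q, hqs, (hcover q hqs).resolve_left fun h => hqt (interior_subset h)⟩
  exact interior_subset hr' (interior_subset hr)

theorem convex_cube {d : ℕ} (a : ℝ) (x : Pt d) : Convex ℝ (cube a x) := by
  intro p hp q hq s t hs ht hst i
  have hpi := abs_le.1 (hp i)
  have hqi := abs_le.1 (hq i)
  obtain rfl : t = 1 - s := by linarith
  simp only [PiLp.add_apply, PiLp.smul_apply, smul_eq_mul]
  rw [abs_le]
  constructor <;> nlinarith [hpi.1, hpi.2, hqi.1, hqi.2]

/-- If `x` is surrounded by a `U`-wall in `Q_n(0)` at scale `u`, then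
no point `y ∈ U` outside the cube `Q_u(x)` is joined to `x` by an edge of a minimal
spanning tree of `U ∪ {x}`. -/
theorem wall_blocks_long_mst_edges (d : ℕ) (hd : 1 ≤ d) (n : ℝ) (hn : 0 < n)
    (U : Finset (Pt d)) (hU : ∀ y ∈ U, y ∈ cube n (0 : Pt d))
    (x : Pt d) (hx : x ∈ cube n (0 : Pt d)) (hxU : x ∉ U)
    (hdd : DistinctDistances (↑(insert x U) : Set (Pt d)))
    (u : ℝ) (hu0 : 0 < u) (hu2 : u < 2 * n)
    (hwall : ∀ x' ∈ cube n (0 : Pt d), x' ∈ frontier (cube u x) →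
      ∃ z ∈ U, ‖z - x‖ ≤ 3 / 4 * ‖x' - x‖ ∧ ‖z - x'‖ ≤ 3 / 4 * ‖x' - x‖)
    (T : SimpleGraph ↥(insert x U)) (hT : IsMST (insert x U) T)
    (y : Pt d) (hy : y ∈ U) (hy' : y ∉ cube u x) :
    ¬ T.Adj ⟨x, Finset.mem_insert_self x U⟩ ⟨y, Finset.mem_insert_of_mem hy⟩ := by
  have hxu : x ∈ cube u x := fun i => by simpa using (half_pos hu0).le
  obtain ⟨x', hseg, hfr⟩ := IsPreconnected.inter_frontier_nonempty (convex_segment x y).isPreconnected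
    ⟨x, left_mem_segment ℝ x y, hxu⟩ ⟨y, right_mem_segment ℝ x y, hy'⟩
  obtain ⟨z, hz, hzx, hzx'⟩ :=
    hwall x' ((convex_cube n 0).segment_subset hx (hU y hy) hseg) hfr
  have hpos : 0 < ‖z - x‖ := norm_pos_iff.2 (sub_ne_zero.2 (by rintro rfl; exact hxU hz))
  have hsum := dist_add_dist_of_mem_segment hseg
  have htri := dist_triangle z x' y
  have hx'y := dist_nonneg (x := x') (y := y)
  simp only [← dist_eq_norm, dist_comm x' x] at hzx hzx' hpos
  exact hT.not_adj_of_dist_lt (c := ⟨z, Finset.mem_insert_of_mem hz⟩)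
    (show dist z x < dist x y by linarith) (show dist z y < dist x y by linarith)

end
end

section
/- Let d ≥ 1, let U be a finite subset of Euclidean space ℝ^d with distinct interpoint distances, let T be a minimal spanning tree of U, let x ∈ U, and let y, z be two distinct points of U which are both adjacent to x in T. Then the angle between the vectors y − x and z − x is at least π/3. -/
open scoped Classical

noncomputable section

namespace SimpleGraph

variable {V : Type*} {G H : SimpleGraph V}

/-- If `H` joins the ends of every edge of `G`, then `H` is connected as soon as `G` is. -/
theorem Connected.of_adj_reachable (hG : G.Connected)
    (h : ∀ a b, G.Adj a b → H.Reachable a b) : H.Connected := by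
  have key : ∀ a b, G.Walk a b → H.Reachable a b := by
    intro a b p
    induction p with
    | nil => exact Reachable.refl _
    | cons hab _ ih => exact (h _ _ hab).trans ih
  have := hG.nonempty
  exact Connected.mk fun a b => (hG a b).elim (key a b)

/-- In an acyclic graph, deleting the edge `xy` separates `y` from every other neighbour of `x`. -/
theorem IsAcyclic.not_reachable_deleteEdges (hG : G.IsAcyclic) {x y z : V} (hyz : y ≠ z)
    (hxy : G.Adj x y) (hxz : G.Adj x z) : ¬ (G.deleteEdges {s(x, y)}).Reachable y z := by
  intro h
  have hz : (G.deleteEdges {s(x, y)}).Adj z x := by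
    rw [deleteEdges_adj]
    refine ⟨hxz.symm, ?_⟩
    simp only [Set.mem_singleton_iff, Sym2.eq_iff]
    rintro (⟨rfl, rfl⟩ | ⟨rfl, -⟩)
    · exact hxz.ne rfl
    · exact hyz rfl
  have hb := isAcyclic_iff_forall_adj_isBridge.1 hG hxy
  exact (isBridge_iff.1 hb) (h.trans hz.reachable).symm

end SimpleGraph

open SimpleGraph hiding dist dist_comm

/-- Exchanging the edge `xy` for `yz`, where `z` is another neighbour of `x`, turns a spanning
tree into a spanning tree. -/
theorem IsSpanningTree.exchange {d : ℕ} {U : Finset (Pt d)} {T : SimpleGraph ↥U}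
    (hT : IsSpanningTree U T) {x y z : ↥U} (hyz : y ≠ z) (hxy : T.Adj x y) (hxz : T.Adj x z) :
    IsSpanningTree U (T.deleteEdges {s(x, y)} ⊔ edge y z) := by
  refine ⟨hT.1.of_adj_reachable fun a b hab => ?_,
    (hT.2.anti (deleteEdges_le _)).sup_edge_of_not_reachable
      (hT.2.not_reachable_deleteEdges hyz hxy hxz)⟩
  have keep : ∀ a b, T.Adj a b → s(a, b) ≠ s(x, y) →
      (T.deleteEdges {s(x, y)} ⊔ edge y z).Reachable a b := fun a b hab hne =>
    Adj.reachable (Or.inl (deleteEdges_adj.2 ⟨hab, hne⟩))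
  have hzy : (T.deleteEdges {s(x, y)} ⊔ edge y z).Reachable z y :=
    Adj.reachable (Or.inr ((adj_edge _ _).2 ⟨Sym2.eq_swap, hyz.symm⟩))
  have hxz' := keep x z hxz fun h => hyz (Sym2.congr_right.1 h).symm
  by_cases hne : s(a, b) = s(x, y)
  · rcases Sym2.eq_iff.1 hne with ⟨rfl, rfl⟩ | ⟨rfl, rfl⟩
    · exact hxz'.trans hzy
    · exact (hxz'.trans hzy).symm
  · exact keep a b hab hne

/-- Two edges of a minimal spanning tree that share an endpoint are at most as long as the
third side of the triangle they span. -/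
theorem IsMST.dist_le {d : ℕ} {U : Finset (Pt d)} {T : SimpleGraph ↥U}
    (hT : IsMST U T) {x y z : ↥U} (hyz : y ≠ z) (hxy : T.Adj x y) (hxz : T.Adj x z) :
    dist (x : Pt d) y ≤ dist (y : Pt d) z := by
  have h := hT.2 _ (hT.1.exchange hyz hxy hxz)
  have hold : T.edgeSet = insert s(x, y) (T.deleteEdges {s(x, y)}).edgeSet := by
    rw [edgeSet_deleteEdges, Set.insert_sdiff_singleton, Set.insert_eq_of_mem]
    exact hxy
  have hnew : (T.deleteEdges {s(x, y)} ⊔ edge y z).edgeSet =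
      insert s(y, z) (T.deleteEdges {s(x, y)}).edgeSet := by
    rw [edgeSet_sup, edgeSet_edge_of_ne hyz, Set.union_singleton]
  have hxy' : s(x, y) ∉ (T.deleteEdges {s(x, y)}).edgeSet := by
    simp [edgeSet_deleteEdges]
  have hyz' : s(y, z) ∉ (T.deleteEdges {s(x, y)}).edgeSet := fun hmem =>
    hT.1.2.not_reachable_deleteEdges hyz hxy hxz (Adj.reachable hmem)
  unfold treeLength at h
  rw [hnew, finsum_mem_insert _ hyz' (Set.toFinite _)] at h
  rw [hold, finsum_mem_insert _ hxy' (Set.toFinite _)] at h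
  simpa only [Sym2.lift_mk, add_le_add_iff_right] using h

/-- The angle between two nonzero vectors is at least `π / 3` if the third side of the triangle
they span is a longest one. -/
theorem InnerProductGeometry.pi_div_three_le_angle {E : Type*} [NormedAddCommGroup E]
    [InnerProductSpace ℝ E] {u v : E} (hu : u ≠ 0) (hv : v ≠ 0)
    (huv : ‖u‖ ≤ ‖u - v‖) (hvu : ‖v‖ ≤ ‖u - v‖) : Real.pi / 3 ≤ angle u v := by
  have hu' := norm_pos_iff.2 hu
  have hv' := norm_pos_iff.2 hv
  have hpi := Real.pi_pos
  refine (Real.strictAntiOn_cos.le_iff_ge ⟨angle_nonneg u v, angle_le_pi u v⟩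
    ⟨by positivity, by linarith⟩).1 ?_
  rw [Real.cos_pi_div_three, cos_angle, div_le_iff₀ (by positivity)]
  have hsq := norm_sub_sq_real u v
  rcases le_total ‖u‖ ‖v‖ with hle | hle <;> nlinarith

/-- Any two edges of a Euclidean minimal spanning tree sharing the
endpoint `x` make an angle of at least `π/3` at `x`. -/
theorem mst_angle_ge_pi_div_three (d : ℕ) (hd : 1 ≤ d) (U : Finset (Pt d))
    (hdd : DistinctDistances (↑U : Set (Pt d)))
    (T : SimpleGraph ↥U) (hT : IsMST U T)
    (x y z : ↥U) (hyz : y ≠ z) (hxy : T.Adj x y) (hxz : T.Adj x z) :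
    Real.pi / 3 ≤
      InnerProductGeometry.angle ((y : Pt d) - (x : Pt d)) ((z : Pt d) - (x : Pt d)) := by
  have hy := hT.dist_le hyz hxy hxz
  have hz := hT.dist_le hyz.symm hxz hxy
  rw [dist_comm (z : Pt d)] at hz
  rw [dist_eq_norm' (x : Pt d), dist_eq_norm (y : Pt d),
    ← sub_sub_sub_cancel_right (y : Pt d) (z : Pt d) (x : Pt d)] at hy hz
  exact InnerProductGeometry.pi_div_three_le_angle
    (sub_ne_zero.2 (Subtype.coe_injective.ne hxy.ne'))
    (sub_ne_zero.2 (Subtype.coe_injective.ne hxz.ne')) hy hz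

end
end

section
/- For every dimension d ≥ 1 there exists a constant κ_d ∈ ℕ, depending only on d, with the following property: for every r > 0, every finite set S ⊂ ℝ^d and every point x ∈ ℝ^d, the number of connected components of the geometric graph satisfies |𝒦_r(S ∪ {x}) − 𝒦_r(S)| ≤ κ_d − 1. -/
open scoped Classical

noncomputable section

/-- `𝒦_r(S)`: the number of connected components of the geometric graph `G_r(S)` on
the finite vertex set `S`, whose edges join distinct points at distance at most `r`. -/
noncomputable def numComponents {d : ℕ} (r : ℝ) (S : Finset (Pt d)) : ℕ :=
  Nat.card
    (SimpleGraph.fromRel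
      (fun u v : ↥S => dist (u : Pt d) (v : Pt d) ≤ r)).ConnectedComponent

section ConnectedComponents

variable {V W : Type*} {G : SimpleGraph V} {H : SimpleGraph W}

/-- If every vertex of `H` other than `x` lies in the image of a homomorphism `f : G →g H`, then
`H` has at most one more component than `G`. -/
theorem SimpleGraph.card_connectedComponent_le_add_one [Finite V] (f : G →g H) (x : W)
    (hf : ∀ w, w = x ∨ w ∈ Set.range f) :
    Nat.card H.ConnectedComponent ≤ Nat.card G.ConnectedComponent + 1 := by
  have hsurj : Function.Surjective
      (fun o : Option G.ConnectedComponent =>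
        o.elim (H.connectedComponentMk x) (fun c => c.map f)) := by
    intro c
    induction c using SimpleGraph.ConnectedComponent.ind with
    | h w =>
      rcases hf w with rfl | ⟨v, rfl⟩
      · exact ⟨none, rfl⟩
      · exact ⟨some (G.connectedComponentMk v), rfl⟩
  simpa [Finite.card_option] using Nat.card_le_card_of_surjective _ hsurj

/-- Suppose every vertex of `H` other than `x` lies in the image of an embedding `f : G ↪g H`.
A walk in `H` starting at `f v`, where the component of `v` has no vertex sent to a neighbour of
`x`, stays in the image of that component. -/
theorem SimpleGraph.Walk.exists_reachable_of_embedding (f : G ↪g H) {x : W}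
    (hf : ∀ w, w = x ∨ w ∈ Set.range f) {a b : W} (p : H.Walk a b) :
    ∀ v : V, f v = a → (∀ u, G.Reachable v u → ¬ H.Adj (f u) x) →
      ∃ u, f u = b ∧ G.Reachable v u := by
  induction p with
  | nil => exact fun v hv _ => ⟨v, hv, .refl v⟩
  | @cons a c b hac p ih =>
    rintro v rfl hv
    rcases hf c with rfl | ⟨w, rfl⟩
    · exact absurd hac (hv v (.refl v))
    · have hvw : G.Reachable v w := (f.map_adj_iff.1 hac).reachable
      obtain ⟨u, hu, hwu⟩ := ih w rfl (fun u hu => hv u (hvw.trans hu))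
      exact ⟨u, hu, hvw.trans hwu⟩

/-- Suppose every vertex of `H` other than `x` lies in the image of an embedding `f : G ↪g H`.
If at most `N` components of `G` have a vertex sent to a neighbour of `x`, then `G` has at most
`N` more components than `H`. -/
theorem SimpleGraph.card_connectedComponent_le_add [Finite V] [Finite W] (f : G ↪g H) (x : W)
    (hf : ∀ w, w = x ∨ w ∈ Set.range f) (N : ℕ)
    (hN : {c : G.ConnectedComponent |
      ∃ v, G.connectedComponentMk v = c ∧ H.Adj (f v) x}.ncard ≤ N) :
    Nat.card G.ConnectedComponent ≤ Nat.card H.ConnectedComponent + N := by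
  set T : Set G.ConnectedComponent :=
    {c | ∃ v, G.connectedComponentMk v = c ∧ H.Adj (f v) x} with hT
  have hinj : Set.InjOn (fun c : G.ConnectedComponent => c.map f.toHom) Tᶜ := by
    intro c hc c' _ hcc'
    induction c using SimpleGraph.ConnectedComponent.ind with
    | h v =>
    induction c' using SimpleGraph.ConnectedComponent.ind with
    | h v' =>
      obtain ⟨p⟩ : H.Reachable (f v) (f v') := SimpleGraph.ConnectedComponent.exact hcc'
      obtain ⟨u, hu, hvu⟩ := p.exists_reachable_of_embedding f hf v rfl
        fun u hu hux => hc ⟨u, SimpleGraph.ConnectedComponent.sound hu.symm, hux⟩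
      rw [← f.injective hu]
      exact SimpleGraph.ConnectedComponent.sound hvu
  have hle : Tᶜ.ncard ≤ Nat.card H.ConnectedComponent := by
    rw [← Set.ncard_univ]
    exact Set.ncard_le_ncard_of_injOn _ (fun _ _ => Set.mem_univ _) hinj
  have hadd := Set.ncard_add_ncard_compl T
  lia

end ConnectedComponents

/-- A finite family of points in a closed ball of radius `r` that are pairwise at distance at
least `r` has at most `Besicovitch.multiplicity E` members. -/
theorem Besicovitch.card_le_multiplicity_of_dist {E ι : Type*} [NormedAddCommGroup E]
    [NormedSpace ℝ E] [FiniteDimensional ℝ E] [Finite ι] {r : ℝ} (hr : 0 < r) (x : E) (g : ι → E)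
    (hx : ∀ i, dist (g i) x ≤ r) (hg : Pairwise fun i j => r ≤ dist (g i) (g j)) :
    Nat.card ι ≤ Besicovitch.multiplicity E := by
  have := Fintype.ofFinite ι
  set h : ι → E := fun i => r⁻¹ • (g i - x) with hh
  have hdist : Pairwise fun i j => 1 ≤ ‖h i - h j‖ := by
    intro i j hij
    have hij' := hg hij
    rw [hh]
    simp only
    rw [← smul_sub, sub_sub_sub_cancel_right, norm_smul, norm_inv, Real.norm_of_nonneg hr.le,
      ← dist_eq_norm, inv_mul_eq_div, one_le_div hr]
    exact hij'
  have hinj : Function.Injective h := by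
    intro i j hij
    by_contra hne
    have h_one : 1 ≤ ‖h i - h j‖ := hdist hne
    rw [hij, sub_self, norm_zero] at h_one
    linarith
  have hcard : (Finset.univ.image h).card = Nat.card ι := by
    rw [Finset.card_image_of_injective _ hinj, Finset.card_univ, Nat.card_eq_fintype_card]
  rw [← hcard]
  refine Besicovitch.card_le_multiplicity ?_ ?_
  · intro c hc
    obtain ⟨i, -, rfl⟩ := Finset.mem_image.1 hc
    rw [hh]
    simp only
    rw [norm_smul, norm_inv, Real.norm_of_nonneg hr.le, ← dist_eq_norm, inv_mul_eq_div,
      div_le_iff₀ hr]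
    linarith [hx i]
  · intro c hc c' hc' hne
    obtain ⟨i, -, rfl⟩ := Finset.mem_image.1 hc
    obtain ⟨j, -, rfl⟩ := Finset.mem_image.1 hc'
    exact hdist fun hij => hne (congrArg h hij)

/-- The inclusion of geometric graphs induced by adding a point. -/
def geometricGraphInsert {d : ℕ} (r : ℝ) (S : Finset (Pt d)) (x : Pt d) :
    SimpleGraph.fromRel (fun u v : ↥S => dist (u : Pt d) (v : Pt d) ≤ r) ↪g
      SimpleGraph.fromRel
        (fun u v : ↥(insert x S : Finset (Pt d)) => dist (u : Pt d) (v : Pt d) ≤ r) where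
  toFun u := ⟨u, Finset.mem_insert_of_mem u.2⟩
  inj' u v huv := Subtype.ext (Subtype.mk.inj huv)
  map_rel_iff' := by
    intro u v
    simp only [SimpleGraph.fromRel_adj, ne_eq, Subtype.ext_iff]
    exact Iff.rfl

/-- For every `d ≥ 1` there is a constant `κ_d`, depending only on
`d` (and which can be taken `≥ 2`), such that adding one point to a finite set changes
the number of connected components of the geometric graph by at most `κ_d − 1`. -/
theorem numComponents_addOne_bound (d : ℕ) (hd : 1 ≤ d) :
    ∃ κ : ℕ, 2 ≤ κ ∧
      ∀ r : ℝ, 0 < r → ∀ S : Finset (Pt d), ∀ x : Pt d,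
        |(numComponents r (insert x S) : ℤ) - (numComponents r S : ℤ)| ≤ (κ : ℤ) - 1 := by
  refine ⟨Besicovitch.multiplicity (Pt d) + 2, by lia, fun r hr S x => ?_⟩
  set f := geometricGraphInsert r S x
  let x' : ↥(insert x S : Finset (Pt d)) := ⟨x, Finset.mem_insert_self x S⟩
  have hf : ∀ w, w = x' ∨ w ∈ Set.range f := by
    rintro ⟨w, hw⟩
    rcases Finset.mem_insert.1 hw with rfl | hwS
    · exact .inl rfl
    · exact .inr ⟨⟨w, hwS⟩, rfl⟩
  have hupper : numComponents r (insert x S) ≤ numComponents r S + 1 :=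
    SimpleGraph.card_connectedComponent_le_add_one f.toHom x' hf
  have hlower : numComponents r S ≤
      numComponents r (insert x S) + Besicovitch.multiplicity (Pt d) := by
    refine SimpleGraph.card_connectedComponent_le_add f x' hf _ ?_
    rw [← Nat.card_coe_set_eq]
    choose g hgc hgx using fun c : {c | ∃ v, SimpleGraph.connectedComponentMk _ v = c ∧
      SimpleGraph.Adj _ (f v) x'} => c.2
    refine Besicovitch.card_le_multiplicity_of_dist hr x (fun c => (g c : Pt d)) ?_ ?_
    · intro c
      obtain ⟨-, h | h⟩ := (SimpleGraph.fromRel_adj _ _ _).1 (hgx c)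
      · exact h
      · exact (dist_comm _ _).trans_le h
    · intro c c' hne
      by_contra! hlt
      have hcc' : g c ≠ g c' := fun h =>
        hne (Subtype.ext ((hgc c).symm.trans ((congrArg _ h).trans (hgc c'))))
      refine hne (Subtype.ext ?_)
      rw [← hgc c, ← hgc c']
      exact SimpleGraph.ConnectedComponent.sound
        ((SimpleGraph.fromRel_adj _ _ _).2 ⟨hcc', .inl hlt.le⟩).reachable
  rw [abs_le]
  push_cast
  omega

end
end

section
/- Let (Ω, ℱ, P) be a probability space, let p ∈ [4, ∞) be real, and let X, Y, Z, W : Ω → ℝ be nonnegative random variables with E[X^p], E[Y^p], E[Z^p], E[W^p] < ∞. Then E[X·Y·Z·W] ≤ E[X]^{1 − 4/p} · ( E[X^4] · E[Y^p] · E[Z^p] · E[W^p] )^{1/p}. -/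
open MeasureTheory

/-- Hölder's inequality for finitely many nonnegative integrable functions with weights summing
to one. -/
theorem integral_prod_rpow_le {α ι : Type*} [MeasurableSpace α] {μ : Measure α}
    (s : Finset ι) {f : ι → α → ℝ} (hf : ∀ i ∈ s, Integrable (f i) μ)
    (hf0 : ∀ i ∈ s, ∀ a, 0 ≤ f i a) {w : ι → ℝ} (hw : ∑ i ∈ s, w i = 1)
    (hw0 : ∀ i ∈ s, 0 ≤ w i) :
    ∫ a, ∏ i ∈ s, f i a ^ w i ∂μ ≤ ∏ i ∈ s, (∫ a, f i a ∂μ) ^ w i := by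
  have hi : ∀ i ∈ s, 0 ≤ ∫ a, f i a ∂μ := fun i his => integral_nonneg (hf0 i his)
  have hprod : ∀ a, 0 ≤ ∏ i ∈ s, f i a ^ w i := fun a =>
    Finset.prod_nonneg fun i his => Real.rpow_nonneg (hf0 i his a) _
  have hmeas : AEStronglyMeasurable (fun a => ∏ i ∈ s, f i a ^ w i) μ :=
    (Finset.aemeasurable_fun_prod s fun i his =>
      (hf i his).aemeasurable.pow_const (w i)).aestronglyMeasurable
  rw [integral_eq_lintegral_of_nonneg_ae (.of_forall hprod) hmeas]
  refine ENNReal.toReal_le_of_le_ofReal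
    (Finset.prod_nonneg fun i his => Real.rpow_nonneg (hi i his) _) ?_
  calc ∫⁻ a, ENNReal.ofReal (∏ i ∈ s, f i a ^ w i) ∂μ
      = ∫⁻ a, ∏ i ∈ s, ENNReal.ofReal (f i a) ^ w i ∂μ := by
        refine lintegral_congr fun a => ?_
        rw [ENNReal.ofReal_prod_of_nonneg fun i his => Real.rpow_nonneg (hf0 i his a) _]
        exact Finset.prod_congr rfl fun i his =>
          (ENNReal.ofReal_rpow_of_nonneg (hf0 i his a) (hw0 i his)).symm
    _ ≤ ∏ i ∈ s, (∫⁻ a, ENNReal.ofReal (f i a) ∂μ) ^ w i :=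
        ENNReal.lintegral_prod_norm_pow_le s
          (fun i his => (hf i his).aemeasurable.ennreal_ofReal) hw hw0
    _ = ENNReal.ofReal (∏ i ∈ s, (∫ a, f i a ∂μ) ^ w i) := by
        rw [ENNReal.ofReal_prod_of_nonneg fun i his => Real.rpow_nonneg (hi i his) _]
        refine Finset.prod_congr rfl fun i his => ?_
        rw [← ofReal_integral_eq_lintegral_ofReal (hf i his) (.of_forall (hf0 i his)),
          ENNReal.ofReal_rpow_of_nonneg (hi i his) (hw0 i his)]

/-- On a finite measure space, a nonnegative function with a finite `p`-th moment has finite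
moments of all smaller orders. -/
theorem integrable_rpow_of_le {α : Type*} [MeasurableSpace α] {μ : Measure α} [IsFiniteMeasure μ]
    {f : α → ℝ} (hfm : Measurable f) (hf0 : ∀ a, 0 ≤ f a) {p q : ℝ} (hq : 0 ≤ q) (hqp : q ≤ p)
    (hf : Integrable (fun a => f a ^ p) μ) : Integrable (fun a => f a ^ q) μ := by
  refine ((integrable_const (1 : ℝ)).add hf).mono' (hfm.pow_const q).aestronglyMeasurable
    (.of_forall fun a => ?_)
  rw [Real.norm_of_nonneg (Real.rpow_nonneg (hf0 a) q)]
  simp only [Pi.add_apply]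
  rcases le_total (f a) 1 with h | h
  · exact (Real.rpow_le_one (hf0 a) h hq).trans
      (le_add_of_nonneg_right (Real.rpow_nonneg (hf0 a) p))
  · exact (Real.rpow_le_rpow_of_exponent_le h hqp).trans (le_add_of_nonneg_left zero_le_one)

/-- A Hölder-type inequality for four nonnegative random variables
with finite `p`-th moments (`p ≥ 4`) on a probability space:
`E[XYZW] ≤ E[X]^{1 − 4/p} (E[X⁴] E[Y^p] E[Z^p] E[W^p])^{1/p}`. -/
theorem holder_four_moments {Ω : Type*} [MeasurableSpace Ω]
    (μ : Measure Ω) [IsProbabilityMeasure μ]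
    (p : ℝ) (hp : 4 ≤ p)
    (X Y Z W : Ω → ℝ)
    (hXm : Measurable X) (hYm : Measurable Y) (hZm : Measurable Z) (hWm : Measurable W)
    (hX0 : ∀ ω, 0 ≤ X ω) (hY0 : ∀ ω, 0 ≤ Y ω) (hZ0 : ∀ ω, 0 ≤ Z ω) (hW0 : ∀ ω, 0 ≤ W ω)
    (hXp : Integrable (fun ω => X ω ^ p) μ) (hYp : Integrable (fun ω => Y ω ^ p) μ)
    (hZp : Integrable (fun ω => Z ω ^ p) μ) (hWp : Integrable (fun ω => W ω ^ p) μ) :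
    ∫ ω, X ω * Y ω * Z ω * W ω ∂μ ≤
      (∫ ω, X ω ∂μ) ^ (1 - 4 / p) *
        ((∫ ω, X ω ^ (4 : ℝ) ∂μ) * (∫ ω, Y ω ^ p ∂μ) * (∫ ω, Z ω ^ p ∂μ) *
            (∫ ω, W ω ^ p ∂μ)) ^ (1 / p) := by
  have hp0 : 0 < p := by linarith
  have hq : 0 ≤ 1 - 4 / p := sub_nonneg.2 ((div_le_one hp0).2 hp)
  have hX1 : Integrable X μ := by
    simpa using integrable_rpow_of_le hXm hX0 zero_le_one (by linarith) hXp
  have hX4 : Integrable (fun ω => X ω ^ (4 : ℝ)) μ :=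
    integrable_rpow_of_le hXm hX0 (by norm_num) hp hXp
  have key := integral_prod_rpow_le (μ := μ) Finset.univ
    (f := ![X, fun ω => X ω ^ (4 : ℝ), fun ω => Y ω ^ p, fun ω => Z ω ^ p, fun ω => W ω ^ p])
    (w := ![1 - 4 / p, 1 / p, 1 / p, 1 / p, 1 / p])
    (by simpa [Fin.forall_fin_succ, hX1, hYp, hZp, hWp] using hX4)
    (by simp [Fin.forall_fin_succ, hX0, hY0, hZ0, hW0, Real.rpow_nonneg])
    (by simp [Fin.sum_univ_succ]; ring)
    (by simpa [Fin.forall_fin_succ] using ⟨by simpa using hq, hp0.le⟩)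
  simp only [Fin.prod_univ_five, Matrix.cons_val] at key
  have hroot : ∀ x : ℝ, 0 ≤ x → (x ^ p) ^ (1 / p) = x := fun x hx => by
    rw [← Real.rpow_mul hx, mul_one_div_cancel hp0.ne', Real.rpow_one]
  have hX : ∀ x : ℝ, 0 ≤ x → x ^ (1 - 4 / p) * (x ^ (4 : ℝ)) ^ (1 / p) = x := fun x hx => by
    rw [← Real.rpow_mul hx, ← Real.rpow_add_of_nonneg hx hq (by positivity)]
    convert Real.rpow_one x using 2
    ring
  have hIX4 : 0 ≤ ∫ ω, X ω ^ (4 : ℝ) ∂μ := integral_nonneg fun ω => Real.rpow_nonneg (hX0 ω) _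
  have hIY : 0 ≤ ∫ ω, Y ω ^ p ∂μ := integral_nonneg fun ω => Real.rpow_nonneg (hY0 ω) _
  have hIZ : 0 ≤ ∫ ω, Z ω ^ p ∂μ := integral_nonneg fun ω => Real.rpow_nonneg (hZ0 ω) _
  have hIW : 0 ≤ ∫ ω, W ω ^ p ∂μ := integral_nonneg fun ω => Real.rpow_nonneg (hW0 ω) _
  rw [Real.mul_rpow (by positivity) hIW, Real.mul_rpow (by positivity) hIZ,
    Real.mul_rpow hIX4 hIY]
  simpa only [hX _ (hX0 _), hroot _ (hY0 _), hroot _ (hZ0 _), hroot _ (hW0 _), ← mul_assoc]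
    using key
end

section
/- Let c ≥ 1 be a real number, let κ ∈ [0, 1], and let γ ∈ (0, 1/(6c)]. If κ ≤ 6cγ + 2cγ·|log γ|·√κ, then κ ≤ 20·c^{3/2}·γ. -/
theorem Real.mul_neg_log_le_half {u : ℝ} (hu : 0 < u) : u * (-Real.log u) ≤ 1 / 2 := by
  have h1 := Real.log_le_sub_one_of_pos (x := (2 * u)⁻¹) (by positivity)
  rw [Real.log_inv, Real.log_mul two_ne_zero hu.ne'] at h1
  have h2 : Real.log 2 ≤ 1 := by
    have := Real.log_le_sub_one_of_pos (x := 2) two_pos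
    linarith
  have h3 : -Real.log u ≤ (2 * u)⁻¹ := by linarith
  calc u * (-Real.log u) ≤ u * (2 * u)⁻¹ := mul_le_mul_of_nonneg_left h3 hu.le
    _ = 1 / 2 := by field_simp

/-- Resolution of the recursive inequality arising in the proof of
the convex-distance bound: if `c ≥ 1`, `κ ∈ [0,1]`, `γ ∈ (0, 1/(6c)]` and
`κ ≤ 6cγ + 2cγ|log γ|√κ`, then `κ ≤ 20 c^{3/2} γ`. -/
theorem recursive_inequality_resolution (c : ℝ) (hc : 1 ≤ c)
    (κ : ℝ) (hκ0 : 0 ≤ κ) (hκ1 : κ ≤ 1)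
    (γ : ℝ) (hγ0 : 0 < γ) (hγ : γ ≤ 1 / (6 * c))
    (h : κ ≤ 6 * c * γ + 2 * c * γ * |Real.log γ| * Real.sqrt κ) :
    κ ≤ 20 * c ^ ((3 : ℝ) / 2) * γ := by
  have hγc : γ * (6 * c) ≤ 1 := (le_div_iff₀ (by positivity)).mp hγ
  have hγ1 : γ ≤ 1 := by nlinarith
  obtain ⟨d, hd, rfl⟩ : ∃ d : ℝ, 1 ≤ d ∧ d ^ 2 = c :=
    ⟨√c, Real.one_le_sqrt.mpr hc, Real.sq_sqrt (by positivity)⟩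
  have hd0 : 0 < d := by linarith
  have hpow : (d ^ 2) ^ ((3 : ℝ) / 2) = d ^ 3 := by
    rw [← Real.rpow_natCast d 2, ← Real.rpow_mul hd0.le, ← Real.rpow_natCast d 3]
    norm_num
  obtain ⟨u, hu, rfl⟩ : ∃ u : ℝ, 0 < u ∧ u ^ 4 = γ := by
    refine ⟨√√γ, by positivity, ?_⟩
    rw [show (4 : ℕ) = 2 * 2 from rfl, pow_mul, Real.sq_sqrt (by positivity),
      Real.sq_sqrt hγ0.le]
  have hL : |Real.log (u ^ 4)| = 4 * (-Real.log u) := by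
    rw [abs_of_nonpos (Real.log_nonpos hγ0.le hγ1), Real.log_pow]
    push_cast
    ring
  have hl0 : 0 ≤ 4 * (-Real.log u) := hL ▸ abs_nonneg _
  have hul := Real.mul_neg_log_le_half hu
  rw [hL] at h
  rw [hpow]
  generalize -Real.log u = l at *
  have hx := Real.sq_sqrt hκ0
  generalize √κ = x at *
  have hdu : d * u ^ 2 ≤ 1 / 2 := by
    refine le_of_sq_le_sq ?_ (by norm_num)
    nlinarith
  have hul2 : (u * l) ^ 2 ≤ 1 / 4 := by
    have : 0 ≤ u * l := mul_nonneg hu.le (by linarith)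
    nlinarith
  -- The inequality of arithmetic and geometric means absorbs the square root into the left-hand side.
  have hyoung : κ ≤ 12 * d ^ 2 * u ^ 4 + 64 * (d ^ 3 * u ^ 4) * ((d * u ^ 2) * (u * l) ^ 2) := by
    nlinarith [sq_nonneg (x - 8 * d ^ 2 * u ^ 4 * l)]
  have hprod : (d * u ^ 2) * (u * l) ^ 2 ≤ 1 / 2 * (1 / 4) := by gcongr
  have h1 := mul_le_mul_of_nonneg_left hprod (by positivity : 0 ≤ 64 * (d ^ 3 * u ^ 4))
  have h2 : d ^ 2 * u ^ 4 ≤ d ^ 3 * u ^ 4 := by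
    gcongr
    norm_num
  linarith
end
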